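/- On the disjoint union W = M ⊔ G define a multiplication by: m · n = m * n for m, n ∈ M; g · h = g * h for g, h ∈ G; m · g = ρ(m, g) for m ∈ M, g ∈ G; and g · m = λ(g, m) for g ∈ G, m ∈ M. Then this multiplication is associative and has identity element 1 ∈ G; hence W is a monoid containing M as a subsemigroup and G as a submonoid. -/

import Mathlib

/-- The multiplication on the disjoint union `M ⊕ G` determined by the
multiplications of `M` and `G` and the mutual actions `l : G → M → M`,
`r : M → G → M`. -/
def unionMul {M G : Type*} [Mul M] [Mul G] (l : G → M → M) (r : M → G → M) :
    M ⊕ G → M ⊕ G → M ⊕ G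
  | .inl m, .inl n => .inl (m * n)
  | .inl m, .inr g => .inl (r m g)
  | .inr g, .inl m => .inl (l g m)
  | .inr g, .inr h => .inr (g * h)

/-- Given a semigroup `M`, a group `G`, and compatible mutual actions `l`, `r`
as in the extension of the semigroup `Ann` of framed annuli by the group
`Ann⁰ ≅ Aut(S¹)` of degenerate annuli, the multiplication `unionMul l r` on
`W = M ⊕ G` is associative with identity `Sum.inr 1`; hence `W` is a monoid
containing `M` as a subsemigroup and `G` as a submonoid. -/
theorem unionMul_monoid {M G : Type*} [Semigroup M] [Group G]
    (l : G → M → M) (r : M → G → M)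
    (hl1 : ∀ m : M, l 1 m = m) (hr1 : ∀ m : M, r m 1 = m)
    (hll : ∀ (g h : G) (m : M), l g (l h m) = l (g * h) m)
    (hrr : ∀ (m : M) (g h : G), r (r m g) h = r m (g * h))
    (hlr : ∀ (g : G) (m : M) (h : G), l g (r m h) = r (l g m) h)
    (hlmul : ∀ (g : G) (m n : M), l g (m * n) = l g m * n)
    (hrmul : ∀ (m n : M) (g : G), r (m * n) g = m * r n g)
    (hmid : ∀ (m : M) (g : G) (n : M), r m g * n = m * l g n) :
    (∀ x y z : M ⊕ G, unionMul l r (unionMul l r x y) z = unionMul l r x (unionMul l r y z)) ∧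
    (∀ x : M ⊕ G, unionMul l r (Sum.inr 1) x = x) ∧
    (∀ x : M ⊕ G, unionMul l r x (Sum.inr 1) = x) ∧
    (∀ m n : M, unionMul l r (Sum.inl m) (Sum.inl n) = Sum.inl (m * n)) ∧
    (∀ g h : G, unionMul l r (Sum.inr g) (Sum.inr h) = Sum.inr (g * h)) ∧
    ∃ _ : Monoid (M ⊕ G),
      (∀ x y : M ⊕ G, x * y = unionMul l r x y) ∧
      (1 : M ⊕ G) = Sum.inr 1 := by
  have assoc : ∀ x y z : M ⊕ G,
      unionMul l r (unionMul l r x y) z = unionMul l r x (unionMul l r y z) := by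
    rintro (x | x) (y | y) (z | z) <;>
      simp only [unionMul, hll, hrr, hlr, hlmul, hrmul, hmid, mul_assoc]
  have one_l : ∀ x : M ⊕ G, unionMul l r (Sum.inr 1) x = x := by
    rintro (x | x) <;> simp only [unionMul, hl1, one_mul]
  have one_r : ∀ x : M ⊕ G, unionMul l r x (Sum.inr 1) = x := by
    rintro (x | x) <;> simp only [unionMul, hr1, mul_one]
  exact ⟨assoc, one_l, one_r, fun _ _ => rfl, fun _ _ => rfl,
    { mul := unionMul l r
      one := Sum.inr 1
      mul_assoc := assoc
      one_mul := one_l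
      mul_one := one_r }, fun _ _ => rfl, rfl⟩
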